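/- Let H be a real Hilbert space and D ⊆ H a dictionary such that the metric entropy of B_1(D) (the closed convex hull of D ∪ (−D)) satisfies ε_n(B_1(D))_H ≤ C n^{−1/2−γ} for all n ≥ 1, for some constants C and γ > 0. Let u ∈ H and let the orthogonal greedy algorithm generate u_0 = 0 and, for n ≥ 1, g_n ∈ D attaining sup_{g∈D} |⟨g, u_{n−1} − u⟩| (assumed attained), with u_n the orthogonal projection of u onto span{g_1, …, g_n}. Then there exists a constant K depending only on C and γ such that for every v with ‖v‖_{K1(D)} < ∞ and every n ≥ 1, ‖u_n − u‖_H² ≤ ‖v − u‖_H² + K ‖v‖_{K1(D)}² n^{−1−2γ}. -/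

import Mathlib

open Set Pointwise
open scoped InnerProductSpace ENNReal

noncomputable section

/-- `B₁(𝔻)`: the closure of the convex hull of `𝔻 ∪ (-𝔻)`. -/
def symmConvexHull {H : Type*} [NormedAddCommGroup H] [NormedSpace ℝ H]
    (D : Set H) : Set H :=
  closure (convexHull ℝ (D ∪ (-D)))

/-- The gauge (variation) norm `‖v‖_{K₁(𝔻)} = inf {c > 0 : v ∈ c·B₁(𝔻)}`. -/
def varNorm {H : Type*} [NormedAddCommGroup H] [NormedSpace ℝ H]
    (D : Set H) (v : H) : ℝ :=
  sInf {c : ℝ | 0 < c ∧ v ∈ c • symmConvexHull D}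

/-- The metric entropy `ε_n(A)`: the infimum (in `ℝ≥0∞`) of the radii `ε > 0` such that `A`
can be covered by at most `2^n` closed balls of radius `ε`; `∞` if no covering exists. -/
def metricEntropy {X : Type*} [NormedAddCommGroup X] (A : Set X) (n : ℕ) : ℝ≥0∞ :=
  ⨅ (ε : ℝ) (_ : 0 < ε ∧ ∃ S : Finset X, S.card ≤ 2 ^ n ∧
    A ⊆ ⋃ c ∈ S, Metric.closedBall c ε), ENNReal.ofReal ε

open MeasureTheory


theorem factorial_le_two_mul_sqrt_pow_mul_Gamma (n : ℕ) (hn : 0 < n) :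
    (n.factorial : ℝ) ≤ (2 * √n) ^ n * Real.Gamma (n / 2 + 1) := by
  have hn' : (0 : ℝ) < n := by exact_mod_cast hn
  have h1 : (n.factorial : ℝ) * √Real.pi
      = 2 ^ n * (Real.Gamma ((n + 1) / 2) * Real.Gamma (n / 2 + 1)) := by
    have := Real.Gamma_mul_Gamma_add_half (((n : ℝ) + 1) / 2)
    rw [show ((n : ℝ) + 1) / 2 + 1 / 2 = n / 2 + 1 by ring,
      show 2 * (((n : ℝ) + 1) / 2) = n + 1 by ring, Real.Gamma_nat_eq_factorial,
      show (1 : ℝ) - (n + 1) = -n by ring, Real.rpow_neg two_pos.le, Real.rpow_natCast] at this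
    rw [this]
    field_simp
  have h2 : Real.Gamma ((n + 1) / 2) ≤ √n ^ n := by
    have := Real.Gamma_mul_add_mul_le_rpow_Gamma_mul_rpow_Gamma (s := 1) (t := n) (a := 1 / 2)
      (b := 1 / 2) one_pos hn' (by norm_num) (by norm_num) (by norm_num)
    rw [Real.Gamma_one, Real.one_rpow, one_mul, ← Real.sqrt_eq_rpow,
      show 1 / 2 * (1 : ℝ) + 1 / 2 * n = (n + 1) / 2 by ring] at this
    refine this.trans (Real.sqrt_le_iff.mpr ⟨by positivity, ?_⟩)
    rw [← pow_mul, mul_comm, pow_mul, Real.sq_sqrt hn'.le]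
    obtain ⟨m, rfl⟩ := Nat.exists_eq_succ_of_ne_zero hn.ne'
    rw [Nat.cast_succ, Real.Gamma_nat_eq_factorial]
    have : (m.factorial : ℝ) ≤ (m.succ.factorial : ℝ) :=
      mod_cast Nat.factorial_le m.le_succ
    exact this.trans (mod_cast Nat.factorial_le_pow _)
  have h3 : 1 ≤ √Real.pi := Real.one_le_sqrt.mpr (by linarith [Real.pi_gt_three])
  have hG : 0 < Real.Gamma ((n : ℝ) / 2 + 1) := Real.Gamma_pos_of_pos (by positivity)
  calc (n.factorial : ℝ) ≤ n.factorial * √Real.pi := le_mul_of_one_le_right (by positivity) h3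
    _ = 2 ^ n * (Real.Gamma ((n + 1) / 2) * Real.Gamma (n / 2 + 1)) := h1
    _ ≤ 2 ^ n * (√n ^ n * Real.Gamma (n / 2 + 1)) := by gcongr
    _ = _ := by ring

/-- If the image of the open cross-polytope under a matrix is covered by `2 ^ n` Euclidean balls
of radius `ε`, then the determinant of the matrix is at most `(2 √π √n ε) ^ n`. -/
theorem abs_det_le_of_crossPolytope_cover {n : ℕ} (hn : 0 < n) (A : Matrix (Fin n) (Fin n) ℝ)
    {ε : ℝ} (hε : 0 < ε) (S : Finset (Fin n → ℝ)) (hS : S.card ≤ 2 ^ n)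
    (hcov : ∀ x : Fin n → ℝ, ∑ i, |x i| < 1 →
      ∃ c ∈ S, ∑ i, (A.mulVec x i - c i) ^ 2 ≤ ε ^ 2) :
    |A.det| ≤ (2 * √Real.pi * √n * ε) ^ n := by
  have : Nonempty (Fin n) := ⟨⟨0, hn⟩⟩
  set P : Set (Fin n → ℝ) := {x | ∑ i, |x i| < 1}
  set B : Set (Fin n → ℝ) := {x | ∑ i, x i ^ 2 ≤ ε ^ 2}
  have hP : volume P = ENNReal.ofReal (2 ^ n / n.factorial) := by
    have := MeasureTheory.volume_sum_rpow_lt_one (Fin n) (p := 1) le_rfl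
    simp only [Real.rpow_one, Fintype.card_fin, div_one, Real.Gamma_nat_eq_factorial] at this
    rw [show (1 : ℝ) + 1 = 2 by norm_num, Real.Gamma_two, mul_one] at this
    exact this
  have hB : volume B = ENNReal.ofReal (ε ^ n * (√Real.pi ^ n / Real.Gamma (n / 2 + 1))) := by
    have := MeasureTheory.volume_sum_rpow_le (Fin n) (p := 2) one_le_two ε
    have hset : {x : Fin n → ℝ | (∑ i, |x i| ^ (2 : ℝ)) ^ (1 / (2 : ℝ)) ≤ ε} = B := by
      ext x
      simp only [mem_ofPred_eq, B, Real.rpow_two, sq_abs, ← Real.sqrt_eq_rpow]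
      exact Real.sqrt_le_left hε.le
    rw [hset, Fintype.card_fin, ← ENNReal.ofReal_pow hε.le,
      ← ENNReal.ofReal_mul (by positivity)] at this
    rw [this, Real.Gamma_add_one (by norm_num), Real.Gamma_one_half_eq]
    congr 4
    ring
  have hsub : A.toLin' '' P ⊆ ⋃ c ∈ S, (fun y => y + -c) ⁻¹' B := by
    rintro _ ⟨x, hx, rfl⟩
    obtain ⟨c, hc, h⟩ := hcov x hx
    simp only [mem_iUnion]
    exact ⟨c, hc, by simpa [B, sub_eq_add_neg] using h⟩
  have hvol : ENNReal.ofReal (|A.det| * (2 ^ n / n.factorial))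
      ≤ ENNReal.ofReal (2 ^ n * (ε ^ n * (√Real.pi ^ n / Real.Gamma (n / 2 + 1)))) := by
    calc _ = volume (A.toLin' '' P) := by
          rw [Measure.addHaar_image_linearMap, LinearMap.det_toLin', hP,
            ENNReal.ofReal_mul (abs_nonneg _)]
      _ ≤ ∑ c ∈ S, volume ((fun y => y + -c) ⁻¹' B) :=
          (measure_mono hsub).trans (measure_biUnion_finset_le _ _)
      _ = S.card * volume B := by simp [measure_preimage_add_right]
      _ ≤ 2 ^ n * volume B := by gcongr; exact_mod_cast hS
      _ = _ := by
          rw [hB, ENNReal.ofReal_mul (p := 2 ^ n) (by positivity)]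
          congr 1
          rw [ENNReal.ofReal_pow two_pos.le]
          simp
  have hG : 0 < Real.Gamma ((n : ℝ) / 2 + 1) := Real.Gamma_pos_of_pos (by positivity)
  rw [ENNReal.ofReal_le_ofReal_iff (by positivity)] at hvol
  have hf : (0 : ℝ) < n.factorial := by positivity
  have hkey : |A.det| * Real.Gamma (n / 2 + 1) ≤ (ε * √Real.pi) ^ n * n.factorial := by
    have h2 : (0 : ℝ) < 2 ^ n := by positivity
    rw [← mul_div_assoc, ← mul_div_assoc, ← mul_div_assoc, div_le_div_iff₀ hf hG] at hvol
    rw [mul_pow]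
    nlinarith
  have := factorial_le_two_mul_sqrt_pow_mul_Gamma n hn
  refine le_of_mul_le_mul_right (hkey.trans ?_) hG
  calc (ε * √Real.pi) ^ n * n.factorial
      ≤ (ε * √Real.pi) ^ n * ((2 * √n) ^ n * Real.Gamma (n / 2 + 1)) := by gcongr
    _ = _ := by rw [← mul_assoc, ← mul_pow]; ring_nf

theorem sum_smul_mem_of_convex {E ι : Type*} [AddCommGroup E] [Module ℝ E] [Fintype ι]
    {K : Set E} (hK : Convex ℝ K) (h0 : (0 : E) ∈ K) {f : ι → E} (hf : ∀ i, f i ∈ K)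
    (hf' : ∀ i, -f i ∈ K) {x : ι → ℝ} (hx : ∑ i, |x i| ≤ 1) : ∑ i, x i • f i ∈ K := by
  rcases (Finset.sum_nonneg fun i _ => abs_nonneg (x i) : 0 ≤ ∑ i, |x i|).eq_or_lt with hs | hs
  · have : ∀ i, x i = 0 := fun i =>
      abs_eq_zero.mp ((Finset.sum_eq_zero_iff_of_nonneg fun i _ => abs_nonneg (x i)).mp hs.symm i
        (Finset.mem_univ i))
    simpa [this] using h0
  · have hmem := hK.centerMass_mem (t := Finset.univ) (w := fun i => |x i|)
      (z := fun i => if 0 ≤ x i then f i else -f i) (fun i _ => abs_nonneg _) hs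
      (fun i _ => by split_ifs; exacts [hf i, hf' i])
    have := hK.smul_mem_of_zero_mem h0 hmem ⟨hs.le, hx⟩
    rw [Finset.centerMass, smul_inv_smul₀ hs.ne'] at this
    convert this using 2 with i
    split_ifs with h
    · rw [abs_of_nonneg h]
    · rw [abs_of_neg (not_le.mp h), smul_neg, neg_smul, neg_neg]

section GramSchmidt

open InnerProductSpace

variable {H : Type*} [NormedAddCommGroup H] [InnerProductSpace ℝ H]

theorem sub_gramSchmidt_mem_span (f : ℕ → H) (k : ℕ) :
    f k - gramSchmidt ℝ f k ∈ Submodule.span ℝ (f '' Iio k) := by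
  rw [← span_gramSchmidt_Iio, gramSchmidt_def, sub_sub_cancel]
  refine Submodule.sum_mem _ fun i hi => ?_
  rw [Submodule.starProjection_singleton]
  exact Submodule.smul_mem _ _ (Submodule.subset_span ⟨i, by simpa using hi, rfl⟩)

theorem inner_gramSchmidt_self (f : ℕ → H) (k : ℕ) :
    ⟪gramSchmidt ℝ f k, f k⟫_ℝ = ‖gramSchmidt ℝ f k‖ ^ 2 := by
  conv_lhs => rw [gramSchmidt_def'' ℝ f k]
  rw [inner_add_right, inner_sum, real_inner_self_eq_norm_sq, Finset.sum_eq_zero, add_zero]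
  intro i hi
  rw [inner_smul_right, gramSchmidt_orthogonal ℝ f (Finset.mem_Iio.mp hi).ne', mul_zero]

/-- Covering the symmetric convex hull of a dictionary by `2 ^ n` balls of radius `ε` bounds the
volume of the parallelepiped spanned by any `n` dictionary elements. -/
theorem prod_norm_gramSchmidt_le {n : ℕ} (hn : 0 < n) {D : Set H} {f : ℕ → H}
    (hf : ∀ k, f k ∈ D) (hne : ∀ k < n, gramSchmidt ℝ f k ≠ 0) {ε : ℝ} (hε : 0 < ε)
    (S : Finset H) (hS : S.card ≤ 2 ^ n)
    (hcov : symmConvexHull D ⊆ ⋃ c ∈ S, Metric.closedBall c ε) :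
    ∏ k ∈ Finset.range n, ‖gramSchmidt ℝ f k‖ ≤ (2 * √Real.pi * √n * ε) ^ n := by
  classical
  let e : Fin n → H := fun k => gramSchmidtNormed ℝ f k
  have he : Orthonormal ℝ e := by
    have hne' : ∀ k : Fin n, gramSchmidtNormed ℝ f k ≠ 0 := fun k => by
      simpa [gramSchmidtNormed] using hne k k.2
    exact (gramSchmidtNormed_orthonormal' (𝕜 := ℝ) f).comp
      (fun k : Fin n => ⟨(k : ℕ), hne' k⟩) fun i j h => Fin.ext (congrArg Subtype.val h)
  let A : Matrix (Fin n) (Fin n) ℝ := Matrix.of fun k i => ⟪e k, f i⟫_ℝ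
  have hdet : A.det = ∏ k ∈ Finset.range n, ‖gramSchmidt ℝ f k‖ := by
    rw [Matrix.det_of_isUpperTriangular, Finset.prod_range]
    · refine Finset.prod_congr rfl fun k _ => ?_
      have : ‖gramSchmidt ℝ f k‖ ≠ 0 := norm_ne_zero_iff.mpr (hne k k.2)
      simp only [A, e, Matrix.of_apply, gramSchmidtNormed, inner_smul_left,
        inner_gramSchmidt_self]
      simp only [RCLike.ofReal_real_eq_id, id, map_inv₀, conj_trivial]
      field_simp
    · intro k i hik
      simp only [id] at hik
      simp [A, e, gramSchmidtNormed, inner_smul_left,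
        gramSchmidt_inv_triangular ℝ f (Fin.lt_def.mp hik)]
  let L : H → Fin n → ℝ := fun x k => ⟪e k, x⟫_ℝ
  rw [← hdet]
  refine (le_abs_self _).trans (abs_det_le_of_crossPolytope_cover hn A hε (S.image L)
    (Finset.card_image_le.trans hS) fun x hx => ?_)
  have hmem : ∑ i, x i • f i ∈ symmConvexHull D := by
    have hpos : ∀ k, f k ∈ convexHull ℝ (D ∪ -D) := fun k =>
      subset_convexHull ℝ _ (Or.inl (hf k))
    have hneg : ∀ k, -f k ∈ convexHull ℝ (D ∪ -D) := fun k =>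
      subset_convexHull ℝ _ (Or.inr (by simpa using hf k))
    refine subset_closure (sum_smul_mem_of_convex (f := fun i : Fin n => f i)
      (convex_convexHull ℝ _) ?_ (fun i => hpos i) (fun i => hneg i) hx.le)
    have := (convex_convexHull ℝ (D ∪ -D)) (hpos 0) (hneg 0) (a := 1 / 2) (b := 1 / 2)
      (by norm_num) (by norm_num) (by norm_num)
    simpa using this
  obtain ⟨c, hc, hxc⟩ : ∃ c ∈ S, ∑ i, x i • f i ∈ Metric.closedBall c ε := by
    simpa only [mem_iUnion, exists_prop] using hcov hmem
  refine ⟨L c, Finset.mem_image_of_mem L hc, ?_⟩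
  have hAx : ∀ k, A.mulVec x k - L c k = ⟪e k, ∑ i, x i • f i - c⟫_ℝ := fun k => by
    simp only [Matrix.mulVec, dotProduct, A, L, Matrix.of_apply, inner_sub_right, inner_sum,
      inner_smul_right, mul_comm]
  calc ∑ k, (A.mulVec x k - L c k) ^ 2 = ∑ k, ‖⟪e k, ∑ i, x i • f i - c⟫_ℝ‖ ^ 2 := by
        simp only [hAx, Real.norm_eq_abs, sq_abs]
    _ ≤ ‖∑ i, x i • f i - c‖ ^ 2 := he.sum_inner_products_le _
    _ ≤ ε ^ 2 := by
        gcongr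
        simpa [dist_eq_norm] using hxc

theorem inner_le_of_mem_smul_symmConvexHull {D : Set H} {r v : H} {c M : ℝ} (hc : 0 < c)
    (hM : ∀ d ∈ D, |⟪d, r⟫_ℝ| ≤ M) (hv : v ∈ c • symmConvexHull D) : ⟪v, r⟫_ℝ ≤ c * M := by
  obtain ⟨w, hw, rfl⟩ := hv
  have hsub : symmConvexHull D ⊆ {x | ⟪x, r⟫_ℝ ≤ M} := by
    refine closure_minimal (convexHull_min ?_ ?_) (isClosed_le (by fun_prop) continuous_const)
    · rintro x (hx | hx)
      · exact (le_abs_self _).trans (hM x hx)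
      · have := hM _ hx
        rw [inner_neg_left, abs_neg] at this
        exact (le_abs_self _).trans this
    · exact convex_halfSpace_le
        ⟨fun x y => inner_add_left x y r, fun a x => real_inner_smul_left x r a⟩ M
  change ⟪c • w, r⟫_ℝ ≤ _
  rw [real_inner_smul_left]
  exact mul_le_mul_of_nonneg_left (hsub hw) hc.le

theorem norm_sub_le_of_forall_inner_eq_zero {V : Submodule ℝ H} {u p w : H} (hp : p ∈ V)
    (hw : w ∈ V) (h : ∀ x ∈ V, ⟪u - p, x⟫_ℝ = 0) : ‖u - p‖ ^ 2 ≤ ‖u - w‖ ^ 2 := by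
  have h0 := h (p - w) (V.sub_mem hp hw)
  have : ‖u - w‖ ^ 2 = ‖u - p‖ ^ 2 + ‖p - w‖ ^ 2 := by
    rw [← sub_add_sub_cancel u p w, norm_add_sq_real, h0]
    ring
  nlinarith [sq_nonneg ‖p - w‖]

/-- One step of orthogonal projection onto an increasing chain of spans. -/
theorem norm_sub_sq_le_sub_inner_sq_div {f : ℕ → H} {u p q : H} {k : ℕ}
    (hp : p ∈ Submodule.span ℝ (f '' Iio k))
    (hp' : ∀ x ∈ Submodule.span ℝ (f '' Iio k), ⟪u - p, x⟫_ℝ = 0)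
    (hq : q ∈ Submodule.span ℝ (f '' Iio (k + 1)))
    (hq' : ∀ x ∈ Submodule.span ℝ (f '' Iio (k + 1)), ⟪u - q, x⟫_ℝ = 0) :
    ‖u - q‖ ^ 2 ≤ ‖u - p‖ ^ 2 - ⟪u - p, f k⟫_ℝ ^ 2 / ‖gramSchmidt ℝ f k‖ ^ 2 := by
  have hinner : ⟪u - p, f k⟫_ℝ = ⟪u - p, gramSchmidt ℝ f k⟫_ℝ := by
    have := hp' _ (sub_gramSchmidt_mem_span f k)
    rwa [inner_sub_right, sub_eq_zero] at this
  have hle : Submodule.span ℝ (f '' Iio k) ≤ Submodule.span ℝ (f '' Iio (k + 1)) :=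
    Submodule.span_mono (image_mono (Iio_subset_Iio k.le_succ))
  have hgs : gramSchmidt ℝ f k ∈ Submodule.span ℝ (f '' Iio (k + 1)) := by
    rw [← span_gramSchmidt_Iio]
    exact Submodule.subset_span ⟨k, k.lt_succ_self, rfl⟩
  set e := gramSchmidt ℝ f k
  set t := ⟪u - p, e⟫_ℝ / ‖e‖ ^ 2
  refine (norm_sub_le_of_forall_inner_eq_zero hq
    (Submodule.add_mem _ (hle hp) (Submodule.smul_mem _ t hgs)) hq').trans_eq ?_
  rw [← sub_sub, norm_sub_sq_real, inner_smul_right, norm_smul, hinner, mul_pow,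
    Real.norm_eq_abs, sq_abs]
  rcases eq_or_ne ‖e‖ 0 with h | h
  · simp [t, h]
  · simp only [t]
    field_simp
    ring

end GramSchmidt

theorem le_of_recursion_of_prod_le {n : ℕ} (hn : 0 < n) {b d : ℕ → ℝ} {Q s : ℝ} (hQ : 0 < Q)
    (hs : 0 < s) (hb : ∀ k ≤ n, 0 < b k) (hd : ∀ k < n, 0 < d k)
    (hrec : ∀ k < n, b (k + 1) ≤ b k - b k ^ 2 / (s * d k))
    (hprod : ∏ k ∈ Finset.range n, d k ≤ Q ^ n) : b n ≤ s * Q / n := by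
  have hn' : (0 : ℝ) < n := by exact_mod_cast hn
  have hstep : ∀ k < n, 1 / b k + 1 / (s * d k) ≤ 1 / b (k + 1) := fun k hk => by
    have h0 := hb k hk.le
    have h1 := hb (k + 1) hk
    have h2 : 0 < s * d k := mul_pos hs (hd k hk)
    have h3 := hrec k hk
    have h4 : b (k + 1) ≤ b k := h3.trans (sub_le_self _ (by positivity))
    have h5 : b k ^ 2 ≤ (b k - b (k + 1)) * (s * d k) := by
      rw [← div_le_iff₀ h2]; linarith
    rw [div_add_div _ _ h0.ne' h2.ne', div_le_div_iff₀ (by positivity) h1]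
    nlinarith
  have hsum : ∀ m ≤ n, ∑ k ∈ Finset.range m, 1 / (s * d k) ≤ 1 / b m := fun m => by
    induction m with
    | zero => intro _; simpa using (hb 0 n.zero_le).le
    | succ m ih =>
      intro hm
      rw [Finset.sum_range_succ]
      linarith [ih (by omega), hstep m (by omega)]
  have hd' : ∀ k ∈ Finset.range n, 0 < d k := fun k hk => hd k (Finset.mem_range.mp hk)
  have hhm := Real.harm_mean_le_geom_mean (Finset.range n) ⟨0, by simpa using hn⟩ (fun _ => 1) d
    (fun _ _ => one_pos) (by simpa using hn) hd'
  simp only [Finset.sum_const, Finset.card_range, nsmul_eq_mul, mul_one, Real.rpow_one] at hhm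
  have hgm : (∏ k ∈ Finset.range n, d k) ^ (n : ℝ)⁻¹ ≤ Q := by
    calc _ ≤ (Q ^ n) ^ (n : ℝ)⁻¹ :=
          Real.rpow_le_rpow (Finset.prod_nonneg fun k hk => (hd' k hk).le) hprod (by positivity)
      _ = Q := Real.pow_rpow_inv_natCast hQ.le hn.ne'
  have hpos : 0 < ∑ k ∈ Finset.range n, 1 / d k :=
    Finset.sum_pos (fun k hk => one_div_pos.mpr (hd' k hk)) ⟨0, by simpa using hn⟩
  have h1 := hhm.trans hgm
  rw [div_le_iff₀ hpos] at h1
  have h2 := hsum n le_rfl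
  have h3 : ∑ k ∈ Finset.range n, 1 / (s * d k) = (∑ k ∈ Finset.range n, 1 / d k) / s := by
    rw [Finset.sum_div]
    exact Finset.sum_congr rfl fun k _ => by rw [div_div, mul_comm]
  have hbn := hb n le_rfl
  rw [h3, div_le_div_iff₀ hs hbn] at h2
  rw [le_div_iff₀ hn']
  calc b n * n ≤ b n * (Q * ∑ k ∈ Finset.range n, 1 / d k) := by gcongr
    _ ≤ s * Q := by nlinarith

theorem exists_cover_of_metricEntropy_lt {X : Type*} [NormedAddCommGroup X] {A : Set X} {n : ℕ}
    {ε : ℝ} (h : metricEntropy A n < ENNReal.ofReal ε) :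
    ∃ S : Finset X, S.card ≤ 2 ^ n ∧ A ⊆ ⋃ c ∈ S, Metric.closedBall c ε := by
  simp only [metricEntropy, iInf_lt_iff] at h
  obtain ⟨δ, ⟨-, S, hS, hA⟩, hδε⟩ := h
  exact ⟨S, hS, hA.trans (iUnion₂_mono fun c _ =>
    Metric.closedBall_subset_closedBall (ENNReal.ofReal_lt_ofReal_iff'.mp hδε).1.le)⟩

/-- The convergence bound of the orthogonal greedy algorithm for a fixed dilation factor `c` with
`v ∈ c • B₁(𝔻)`. -/
theorem oga_bound_of_mem_smul {C γ : ℝ} {H : Type*} [NormedAddCommGroup H]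
    [InnerProductSpace ℝ H] {D : Set H}
    (hD : ∀ n : ℕ, 1 ≤ n →
      metricEntropy (symmConvexHull D) n ≤ ENNReal.ofReal (C * (n : ℝ) ^ (-(1/2 : ℝ) - γ)))
    {u : H} {uIter g : ℕ → H} (h0 : uIter 0 = 0) (hgD : ∀ n : ℕ, 1 ≤ n → g n ∈ D)
    (hgmax : ∀ n : ℕ, 1 ≤ n → ∀ d ∈ D,
      |⟪d, uIter (n - 1) - u⟫_ℝ| ≤ |⟪g n, uIter (n - 1) - u⟫_ℝ|)
    (hproj : ∀ n : ℕ, 1 ≤ n → uIter n ∈ Submodule.span ℝ (g '' Set.Icc 1 n) ∧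
      ∀ w ∈ Submodule.span ℝ (g '' Set.Icc 1 n), ⟪u - uIter n, w⟫_ℝ = 0)
    {v : H} {c : ℝ} (hc : 0 < c) (hv : v ∈ c • symmConvexHull D) {n : ℕ} (hn : 1 ≤ n) :
    ‖uIter n - u‖ ^ 2 ≤ ‖v - u‖ ^ 2
      + 16 * Real.pi * (|C| + 1) ^ 2 * c ^ 2 * (n : ℝ) ^ (-1 - 2 * γ) := by
  have hn' : (0 : ℝ) < n := by exact_mod_cast hn
  let f : ℕ → H := fun k => g (k + 1)
  have hspan : ∀ k, g '' Icc 1 k = f '' Iio k := fun k => by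
    ext x
    constructor
    · rintro ⟨i, ⟨hi, hik⟩, rfl⟩
      exact ⟨i - 1, by simp only [mem_Iio]; omega, by simp only [f, Nat.sub_add_cancel hi]⟩
    · rintro ⟨i, hi, rfl⟩
      exact ⟨i + 1, ⟨by omega, hi⟩, rfl⟩
  have hP : ∀ k, uIter k ∈ Submodule.span ℝ (f '' Iio k) ∧
      ∀ w ∈ Submodule.span ℝ (f '' Iio k), ⟪u - uIter k, w⟫_ℝ = 0 := fun k => by
    rcases k.eq_zero_or_pos with rfl | hk
    · simp [h0]
    · rw [← hspan]
      exact hproj k hk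
  have hstep : ∀ k, ‖u - uIter (k + 1)‖ ^ 2 ≤ ‖u - uIter k‖ ^ 2
      - ⟪u - uIter k, f k⟫_ℝ ^ 2 / ‖InnerProductSpace.gramSchmidt ℝ f k‖ ^ 2 := fun k =>
    norm_sub_sq_le_sub_inner_sq_div (hP k).1 (hP k).2 (hP (k + 1)).1 (hP (k + 1)).2
  set b : ℕ → ℝ := fun k => ‖u - uIter k‖ ^ 2 - ‖v - u‖ ^ 2 with hb
  have hbinner : ∀ k, b k ≤ 2 * c * |⟪u - uIter k, f k⟫_ℝ| := fun k => by
    have hmax : ∀ d ∈ D, |⟪d, u - uIter k⟫_ℝ| ≤ |⟪u - uIter k, f k⟫_ℝ| := fun d hd => by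
      have := hgmax (k + 1) (by omega) d hd
      rw [Nat.add_sub_cancel, ← neg_sub u, inner_neg_right, inner_neg_right, abs_neg, abs_neg,
        real_inner_comm _ (g (k + 1))] at this
      exact this
    have h1 := inner_le_of_mem_smul_symmConvexHull hc hmax hv
    have h2 : ‖u - uIter k‖ ^ 2 = ⟪u - v, u - uIter k⟫_ℝ + ⟪v, u - uIter k⟫_ℝ := by
      rw [← inner_add_left, sub_add_cancel, ← real_inner_self_eq_norm_sq]
      conv_lhs => rw [inner_sub_left, real_inner_comm, real_inner_comm _ (uIter k)]
      rw [(hP k).2 _ (hP k).1, sub_zero, real_inner_comm]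
    have h3 := real_inner_le_norm (u - v) (u - uIter k)
    simp only [hb]
    rw [norm_sub_rev v u]
    nlinarith [sq_nonneg (‖u - v‖ - ‖u - uIter k‖)]
  have hanti : Antitone b := antitone_nat_of_succ_le fun k => by
    have : 0 ≤ ⟪u - uIter k, f k⟫_ℝ ^ 2 / ‖InnerProductSpace.gramSchmidt ℝ f k‖ ^ 2 := by
      positivity
    simp only [hb]
    linarith [hstep k]
  suffices b n ≤ 16 * Real.pi * (|C| + 1) ^ 2 * c ^ 2 * (n : ℝ) ^ (-1 - 2 * γ) by
    rw [norm_sub_rev]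
    linarith
  rcases le_or_gt (b n) 0 with hbn | hbn
  · exact hbn.trans (by positivity)
  have hbpos : ∀ k ≤ n, 0 < b k := fun k hk => hbn.trans_le (hanti hk)
  have hgs : ∀ k < n, InnerProductSpace.gramSchmidt ℝ f k ≠ 0 := fun k hk hzero => by
    have h1 := (hP k).2 _ (sub_gramSchmidt_mem_span f k)
    rw [hzero, sub_zero] at h1
    have h2 := hbinner k
    rw [h1, abs_zero, mul_zero] at h2
    exact h2.not_gt (hbpos k hk.le)
  set ε : ℝ := (|C| + 1) * (n : ℝ) ^ (-(1 / 2 : ℝ) - γ) with hε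
  have hεpos : 0 < ε := by positivity
  obtain ⟨S, hS, hcov⟩ := exists_cover_of_metricEntropy_lt
    ((hD n hn).trans_lt ((ENNReal.ofReal_lt_ofReal_iff hεpos).mpr
      (mul_lt_mul_of_pos_right (by linarith [le_abs_self C]) (by positivity))))
  have hprod := prod_norm_gramSchmidt_le hn (fun k => hgD (k + 1) (by omega)) hgs hεpos S hS hcov
  have hprod' : ∏ k ∈ Finset.range n, ‖InnerProductSpace.gramSchmidt ℝ f k‖ ^ 2
      ≤ (4 * Real.pi * n * ε ^ 2) ^ n := by
    rw [Finset.prod_pow]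
    calc _ ≤ ((2 * √Real.pi * √n * ε) ^ n) ^ 2 := by gcongr
      _ = (4 * Real.pi * n * ε ^ 2) ^ n := by
        rw [← pow_mul, mul_comm n, pow_mul]
        simp only [mul_pow, Real.sq_sqrt Real.pi_pos.le, Real.sq_sqrt hn'.le]
        norm_num
  have hrec : ∀ k < n, b (k + 1) ≤ b k
      - b k ^ 2 / (4 * c ^ 2 * ‖InnerProductSpace.gramSchmidt ℝ f k‖ ^ 2) := fun k hk => by
    have h1 : b k ^ 2 ≤ 4 * c ^ 2 * ⟪u - uIter k, f k⟫_ℝ ^ 2 := by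
      have := pow_le_pow_left₀ (hbpos k hk.le).le (hbinner k) 2
      rw [mul_pow, sq_abs, mul_pow] at this
      linarith
    have hd : 0 < ‖InnerProductSpace.gramSchmidt ℝ f k‖ := norm_pos_iff.mpr (hgs k hk)
    have h2 : b k ^ 2 / (4 * c ^ 2 * ‖InnerProductSpace.gramSchmidt ℝ f k‖ ^ 2)
        ≤ ⟪u - uIter k, f k⟫_ℝ ^ 2 / ‖InnerProductSpace.gramSchmidt ℝ f k‖ ^ 2 := by
      rw [← div_div]
      gcongr
      rw [div_le_iff₀ (by positivity)]
      linarith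
    have h3 := hstep k
    simp only [hb] at h2 ⊢
    linarith
  refine (le_of_recursion_of_prod_le hn (by positivity) (by positivity) hbpos
    (fun k hk => pow_pos (norm_pos_iff.mpr (hgs k hk)) 2) hrec hprod').trans_eq ?_
  have hε2 : ε ^ 2 = (|C| + 1) ^ 2 * (n : ℝ) ^ (-1 - 2 * γ) := by
    rw [hε, mul_pow, ← Real.rpow_mul_natCast hn'.le]
    congr 2
    push_cast
    ring
  rw [hε2]
  field_simp
  ring

/-- **Convergence of the orthogonal greedy algorithm under entropy decay.**
Let `H` be a real Hilbert space and `𝔻 ⊆ H` a dictionary whose convex-hull metric entropy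
satisfies `ε_n(B₁(𝔻)) ≤ C n^{−1/2−γ}` for all `n ≥ 1`, for some `γ > 0`. Let `u ∈ H` and let
the orthogonal greedy algorithm generate `u₀ = 0`, `g_n = argmax_{g∈𝔻} |⟨g, u_{n−1} − u⟩|`,
with `u_n` the orthogonal projection of `u` onto `span{g_1, …, g_n}`. Then there is a
constant `K` depending only on `C` and `γ` such that for every `v` with
`‖v‖_{K₁(𝔻)} < ∞` and every `n ≥ 1`,
`‖u_n − u‖² ≤ ‖v − u‖² + K ‖v‖²_{K₁(𝔻)} n^{−1−2γ}`. -/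
theorem oga_convergence (C γ : ℝ) (hγ : 0 < γ) :
    ∃ K : ℝ, ∀ (H : Type) (_i1 : NormedAddCommGroup H) (_i2 : InnerProductSpace ℝ H)
      (_i3 : CompleteSpace H) (D : Set H),
      (∀ n : ℕ, 1 ≤ n →
        metricEntropy (symmConvexHull D) n ≤ ENNReal.ofReal (C * (n : ℝ) ^ (-(1/2 : ℝ) - γ))) →
      ∀ (u : H) (uIter g : ℕ → H),
        uIter 0 = 0 →
        (∀ n : ℕ, 1 ≤ n → g n ∈ D) →
        (∀ n : ℕ, 1 ≤ n → ∀ d ∈ D,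
          |⟪d, uIter (n - 1) - u⟫_ℝ| ≤ |⟪g n, uIter (n - 1) - u⟫_ℝ|) →
        (∀ n : ℕ, 1 ≤ n → uIter n ∈ Submodule.span ℝ (g '' Set.Icc 1 n) ∧
          ∀ w ∈ Submodule.span ℝ (g '' Set.Icc 1 n), ⟪u - uIter n, w⟫_ℝ = 0) →
        ∀ v : H, (∃ c : ℝ, 0 < c ∧ v ∈ c • symmConvexHull D) →
          ∀ n : ℕ, 1 ≤ n →
            ‖uIter n - u‖ ^ 2 ≤ ‖v - u‖ ^ 2
              + K * (varNorm D v) ^ 2 * (n : ℝ) ^ (-1 - 2 * γ) := by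
  refine ⟨16 * Real.pi * (|C| + 1) ^ 2, ?_⟩
  intro H _ _ _ D hD u uIter g h0 hgD hgmax hproj v hv n hn
  have hbound : ∀ c ∈ {c : ℝ | 0 < c ∧ v ∈ c • symmConvexHull D}, ‖uIter n - u‖ ^ 2 ≤
      ‖v - u‖ ^ 2 + 16 * Real.pi * (|C| + 1) ^ 2 * c ^ 2 * (n : ℝ) ^ (-1 - 2 * γ) := by
    rintro c ⟨hc, hvc⟩
    exact oga_bound_of_mem_smul hD h0 hgD hgmax hproj hc hvc hn
  have hK : 0 < 16 * Real.pi * (|C| + 1) ^ 2 * (n : ℝ) ^ (-1 - 2 * γ) := by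
    have : (0 : ℝ) < n := by exact_mod_cast hn
    positivity
  have hsqrt : √((‖uIter n - u‖ ^ 2 - ‖v - u‖ ^ 2) /
      (16 * Real.pi * (|C| + 1) ^ 2 * (n : ℝ) ^ (-1 - 2 * γ))) ≤ varNorm D v := by
    refine le_csInf hv fun c hc => Real.sqrt_le_iff.mpr ⟨hc.1.le, ?_⟩
    rw [div_le_iff₀ hK]
    linarith [hbound c hc]
  have := (Real.sqrt_le_iff.mp hsqrt).2
  rw [div_le_iff₀ hK] at this
  linarith
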